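/- Let G = S_4, let C be the subgroup of order 2 generated by the permutation (1 3)(2 4) (a product of two disjoint transpositions), and let λ : G → Sym(G⧸C) be the homomorphism given by left translation on the 12-element set of left cosets. Then no regular subgroup of Sym(G⧸C) is normalized by λ(G). -/

import Mathlib

/-- A subgroup of the symmetric group of `X` is regular if it is transitive and
every point stabilizer in it is trivial. -/
def IsRegularSubgroup {X : Type*} (N : Subgroup (Equiv.Perm X)) : Prop :=
  (∀ x y : X, ∃ σ ∈ N, σ x = y) ∧ (∀ σ ∈ N, ∀ x : X, σ x = x → σ = 1)

/-- The double transposition `(1 3)(2 4)` in `S₄` (on `Fin 4 = {0, 1, 2, 3}`). -/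
def c : Equiv.Perm (Fin 4) := Equiv.swap 0 2 * Equiv.swap 1 3

/-- Left translation by the 4-cycle on the twelve cosets. -/
def tabS : Fin 12 → Fin 12 := ![8, 4, 9, 2, 6, 7, 11, 5, 0, 10, 3, 1]

/-- Left translation by the transposition on the twelve cosets. -/
def tabT : Fin 12 → Fin 12 := ![6, 7, 4, 8, 2, 9, 0, 1, 3, 5, 11, 10]

/-- Representatives of the twelve cosets. -/
def rep (i : Fin 12) : Equiv.Perm (Fin 4) where
  toFun := (![![0, 1, 2, 3], ![0, 1, 3, 2], ![0, 2, 1, 3], ![0, 2, 3, 1], ![0, 3, 1, 2], ![0, 3, 2, 1], ![1, 0, 2, 3], ![1, 0, 3, 2], ![1, 2, 3, 0], ![1, 3, 2, 0], ![2, 0, 3, 1], ![2, 1, 3, 0]] :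
    Fin 12 → Fin 4 → Fin 4) i
  invFun := (![![0, 1, 2, 3], ![0, 1, 3, 2], ![0, 2, 1, 3], ![0, 3, 1, 2], ![0, 2, 3, 1], ![0, 3, 2, 1], ![1, 0, 2, 3], ![1, 0, 3, 2], ![3, 0, 1, 2], ![3, 0, 2, 1], ![1, 3, 0, 2], ![3, 1, 0, 2]] :
    Fin 12 → Fin 4 → Fin 4) i
  left_inv := by revert i; decide
  right_inv := by revert i; decide

def genS : Equiv.Perm (Fin 4) where
  toFun := ![1, 2, 3, 0]
  invFun := ![3, 0, 1, 2]
  left_inv := by decide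
  right_inv := by decide

def genT : Equiv.Perm (Fin 4) := Equiv.swap 0 1

/-- Facts `(x, y, z, w)`: the element of `N` taking `x` to `y` takes `z` to `w`. -/
abbrev Quad := Fin 12 × Fin 12 × Fin 12 × Fin 12

/-- Derivations of facts from hypotheses. -/
inductive Deriv : Type
  | hy : ℕ → Deriv
  | rf : Fin 12 → Fin 12 → Deriv
  | idn : Fin 12 → Fin 12 → Deriv
  | sy : Deriv → Deriv
  | iv : Deriv → Deriv
  | tr : Deriv → Deriv → Deriv
  | co : Deriv → Deriv → Deriv
  | S : Deriv → Deriv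
  | T : Deriv → Deriv

/-- The fact proved by a derivation. -/
def Deriv.eval (H : List Quad) : Deriv → Option Quad
  | .hy n => H[n]?
  | .rf x y => some (x, y, x, y)
  | .idn x z => some (x, x, z, z)
  | .sy d => match d.eval H with
    | some (x, y, z, w) => some (z, w, x, y)
    | none => none
  | .iv d => match d.eval H with
    | some (x, y, z, w) => some (y, x, w, z)
    | none => none
  | .tr d e => match d.eval H, e.eval H with
    | some (x, y, z, w), some (z', w', u, v) =>
      if z = z' ∧ w = w' then some (x, y, u, v) else none
    | _, _ => none
  | .co d e => match d.eval H, e.eval H with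
    | some (x, y, z, w), some (y', u, w', v) =>
      if y = y' ∧ w = w' then some (x, u, z, v) else none
    | _, _ => none
  | .S d => match d.eval H with
    | some (x, y, z, w) => some (tabS x, tabS y, tabS z, tabS w)
    | none => none
  | .T d => match d.eval H with
    | some (x, y, z, w) => some (tabT x, tabT y, tabT z, tabT w)
    | none => none

/-- Case-distinction trees whose leaves are pairs of contradictory derivations. -/
inductive CaseTree : Type
  | leaf : Deriv → Deriv → CaseTree
  | node : Fin 12 → Fin 12 → Fin 12 → (Fin 12 → CaseTree) → CaseTree

/-- Two contradictory facts. -/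
def clash : Option Quad → Option Quad → Bool
  | some (x, y, z, w), some (x', y', z', w') =>
    decide (x = x' ∧ y = y' ∧ z = z' ∧ w ≠ w')
  | _, _ => false

/-- Validity of a case tree. -/
def CaseTree.check : CaseTree → List Quad → Bool
  | .leaf d e, H => clash (d.eval H) (e.eval H)
  | .node x y z f, H => decide (∀ w, (f w).check (H ++ [(x, y, z, w)]) = true)

/-- The case tree refuting a regular normalized subgroup. -/
def theTree : CaseTree :=
  .node 0 3 8 ![
    .leaf (.sy (.S (.S (.hy 0)))) (.sy (.hy 0)),
    .leaf (.co (.iv (.sy (.S (.hy 0)))) (.hy 0)) (.iv (.T (.S (.hy 0)))),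
    .leaf (.sy (.hy 0)) (.S (.hy 0)),
    .leaf (.iv (.hy 0)) (.rf 3 0),
    .leaf (.tr (.T (.co (.iv (.hy 0)) (.sy (.S (.hy 0))))) (.co (.iv (.S (.hy 0))) (.sy (.hy 0)))) (.S (.T (.co (.iv (.sy (.S (.hy 0)))) (.hy 0)))),
    .leaf (.sy (.S (.S (.hy 0)))) (.sy (.hy 0)),
    .node 0 7 1 ![
      .leaf (.iv (.S (.S (.hy 1)))) (.iv (.hy 1)),
      .leaf (.sy (.hy 1)) (.idn 1 0),
      .leaf (.T (.co (.iv (.hy 1)) (.sy (.S (.S (.T (.S (.S (.hy 1))))))))) (.tr (.sy (.tr (.co (.sy (.hy 0)) (.T (.S (.S (.hy 0))))) (.hy 1))) (.S (.hy 1))),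
      .leaf (.tr (.co (.iv (.S (.S (.hy 0)))) (.hy 0)) (.iv (.T (.hy 1)))) (.tr (.iv (.T (.S (.hy 1)))) (.sy (.S (.hy 1)))),
      .leaf (.tr (.co (.iv (.sy (.hy 1))) (.S (.S (.T (.S (.S (.hy 1))))))) (.sy (.T (.hy 1)))) (.S (.S (.tr (.iv (.sy (.T (.S (.S (.T (.hy 1))))))) (.hy 1)))),
      .leaf (.iv (.S (.S (.hy 1)))) (.iv (.hy 1)),
      .node 0 1 2 ![
        .leaf (.iv (.sy (.S (.S (.T (.S (.hy 2))))))) (.iv (.T (.S (.co (.sy (.hy 2)) (.hy 1))))),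
        .leaf (.iv (.hy 2)) (.rf 1 0),
        .leaf (.sy (.hy 2)) (.idn 2 0),
        .leaf (.co (.tr (.tr (.co (.iv (.S (.S (.hy 0)))) (.hy 0)) (.sy (.hy 1))) (.S (.S (.hy 1)))) (.iv (.sy (.hy 2)))) (.iv (.S (.T (.S (.hy 2))))),
        .leaf (.iv (.co (.hy 2) (.tr (.sy (.tr (.co (.sy (.hy 0)) (.T (.S (.S (.hy 0))))) (.hy 1))) (.S (.hy 1))))) (.T (.S (.S (.hy 2)))),
        .leaf (.sy (.tr (.iv (.S (.T (.hy 2)))) (.T (.S (.T (.hy 0)))))) (.tr (.sy (.S (.S (.T (.S (.S (.hy 2))))))) (.iv (.hy 2))),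
        .leaf (.co (.tr (.T (.S (.S (.hy 1)))) (.hy 1)) (.iv (.hy 2))) (.iv (.S (.S (.hy 2)))),
        .leaf (.iv (.sy (.co (.T (.S (.S (.hy 2)))) (.hy 1)))) (.iv (.sy (.S (.S (.T (.hy 2)))))),
        .leaf (.sy (.S (.S (.T (.S (.tr (.iv (.hy 2)) (.S (.hy 0)))))))) (.T (.S (.co (.iv (.hy 1)) (.sy (.tr (.iv (.hy 2)) (.S (.hy 0))))))),
        .leaf (.iv (.S (.T (.S (.hy 2))))) (.iv (.sy (.hy 2))),
        .leaf (.iv (.tr (.T (.S (.hy 1))) (.sy (.hy 2)))) (.co (.iv (.S (.S (.hy 0)))) (.hy 0)),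
        .leaf (.iv (.sy (.S (.S (.hy 2))))) (.sy (.T (.hy 2)))],
      .leaf (.iv (.hy 1)) (.rf 7 0),
      .leaf (.iv (.S (.S (.hy 1)))) (.iv (.hy 1)),
      .leaf (.S (.tr (.S (.T (.S (.hy 1)))) (.iv (.sy (.hy 1))))) (.tr (.co (.iv (.S (.S (.hy 0)))) (.hy 0)) (.iv (.T (.hy 1)))),
      .leaf (.co (.iv (.S (.T (.hy 1)))) (.sy (.T (.S (.S (.T (.S (.hy 1)))))))) (.tr (.sy (.tr (.co (.hy 0) (.sy (.T (.S (.S (.hy 0)))))) (.S (.hy 1)))) (.hy 1)),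
      .leaf (.tr (.co (.iv (.sy (.hy 1))) (.S (.S (.T (.S (.S (.hy 1))))))) (.sy (.T (.hy 1)))) (.S (.S (.tr (.iv (.sy (.T (.S (.S (.T (.hy 1))))))) (.hy 1))))],
    .leaf (.sy (.S (.S (.hy 0)))) (.sy (.hy 0)),
    .leaf (.sy (.hy 0)) (.idn 8 0),
    .node 0 1 2 ![
      .leaf (.tr (.S (.T (.co (.iv (.sy (.hy 0))) (.S (.hy 0))))) (.hy 1)) (.T (.S (.S (.T (.S (.S (.hy 1))))))),
      .leaf (.iv (.hy 1)) (.rf 1 0),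
      .leaf (.sy (.hy 1)) (.idn 2 0),
      .leaf (.tr (.co (.iv (.hy 0)) (.sy (.S (.hy 0)))) (.sy (.S (.hy 1)))) (.T (.S (.S (.S (.hy 1))))),
      .leaf (.tr (.iv (.sy (.S (.S (.T (.S (.S (.hy 0)))))))) (.co (.sy (.T (.S (.hy 1)))) (.hy 1))) (.tr (.co (.co (.S (.hy 1)) (.sy (.T (.hy 1)))) (.S (.T (.S (.hy 1))))) (.iv (.sy (.hy 0)))),
      .leaf (.tr (.S (.T (.co (.iv (.sy (.hy 0))) (.S (.hy 0))))) (.hy 1)) (.T (.S (.S (.T (.S (.S (.hy 1))))))),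
      .leaf (.iv (.S (.T (.S (.hy 0))))) (.iv (.sy (.hy 1))),
      .leaf (.S (.tr (.T (.S (.S (.S (.hy 1))))) (.sy (.hy 0)))) (.tr (.iv (.T (.S (.hy 1)))) (.sy (.S (.hy 1)))),
      .leaf (.tr (.S (.T (.co (.iv (.sy (.hy 0))) (.S (.hy 0))))) (.hy 1)) (.T (.S (.S (.T (.S (.S (.hy 1))))))),
      .leaf (.iv (.S (.T (.S (.hy 1))))) (.iv (.sy (.hy 1))),
      .leaf (.tr (.co (.iv (.hy 0)) (.S (.S (.hy 0)))) (.sy (.S (.hy 1)))) (.sy (.S (.S (.S (.hy 1))))),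
      .leaf (.iv (.sy (.S (.S (.hy 1))))) (.sy (.T (.hy 1)))],
    .leaf (.sy (.S (.hy 0))) (.hy 0),
    .leaf (.tr (.S (.S (.co (.iv (.hy 0)) (.sy (.S (.hy 0)))))) (.T (.co (.iv (.S (.hy 0))) (.sy (.hy 0))))) (.S (.T (.S (.co (.iv (.sy (.S (.hy 0)))) (.hy 0)))))]

theorem theTree_check : theTree.check [] = true := by decide +kernel

/-- The combinatorial core: `r x y z w` says that the element of `N` taking `x` to `y`
takes `z` to `w`. -/
theorem heap_core (r : Fin 12 → Fin 12 → Fin 12 → Fin 12 → Prop)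
    (tot : ∀ x y z, ∃ w, r x y z w)
    (fn : ∀ {x y z w w'}, w ≠ w' → r x y z w → r x y z w' → False)
    (rf : ∀ x y, r x y x y) (idn : ∀ x z, r x x z z)
    (sy : ∀ {x y z w}, r x y z w → r z w x y)
    (iv : ∀ {x y z w}, r x y z w → r y x w z)
    (tr : ∀ {x y z w u v}, r x y z w → r z w u v → r x y u v)
    (co : ∀ {x y z w u v}, r x y z w → r y u w v → r x u z v)
    (S : ∀ {x y z w}, r x y z w → r (tabS x) (tabS y) (tabS z) (tabS w))
    (T : ∀ {x y z w}, r x y z w → r (tabT x) (tabT y) (tabT z) (tabT w)) : False := by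
  have sound : ∀ (H : List Quad), (∀ f ∈ H, r f.1 f.2.1 f.2.2.1 f.2.2.2) →
      ∀ (d : Deriv) (f : Quad), d.eval H = some f → r f.1 f.2.1 f.2.2.1 f.2.2.2 := by
    intro H hH d
    induction d with
    | hy n =>
      intro f hf
      exact hH f (List.mem_of_getElem? hf)
    | rf x y =>
      intro f hf
      simp only [Deriv.eval, Option.some.injEq] at hf
      subst hf
      exact rf x y
    | idn x y =>
      intro f hf
      simp only [Deriv.eval, Option.some.injEq] at hf
      subst hf
      exact idn x y
    | sy d ih =>
      intro f hf
      simp only [Deriv.eval] at hf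
      split at hf
      · rename_i h
        cases hf
        exact sy (ih _ h)
      · cases hf
    | iv d ih =>
      intro f hf
      simp only [Deriv.eval] at hf
      split at hf
      · rename_i h
        cases hf
        exact iv (ih _ h)
      · cases hf
    | S d ih =>
      intro f hf
      simp only [Deriv.eval] at hf
      split at hf
      · rename_i h
        cases hf
        exact S (ih _ h)
      · cases hf
    | T d ih =>
      intro f hf
      simp only [Deriv.eval] at hf
      split at hf
      · rename_i h
        cases hf
        exact T (ih _ h)
      · cases hf
    | tr d e ihd ihe =>
      intro f hf
      simp only [Deriv.eval] at hf
      split at hf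
      · rename_i h1 h2
        have g1 := ihd _ h1
        have g2 := ihe _ h2
        split at hf
        · rename_i h
          obtain ⟨rfl, rfl⟩ := h
          cases hf
          exact tr g1 g2
        · cases hf
      · cases hf
    | co d e ihd ihe =>
      intro f hf
      simp only [Deriv.eval] at hf
      split at hf
      · rename_i h1 h2
        have g1 := ihd _ h1
        have g2 := ihe _ h2
        split at hf
        · rename_i h
          obtain ⟨rfl, rfl⟩ := h
          cases hf
          exact co g1 g2
        · cases hf
      · cases hf
  have main : ∀ (t : CaseTree) (H : List Quad), (∀ f ∈ H, r f.1 f.2.1 f.2.2.1 f.2.2.2) →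
      t.check H = true → False := by
    intro t
    induction t with
    | leaf d e =>
      intro H hH h
      simp only [CaseTree.check] at h
      unfold clash at h
      split at h
      · rename_i h1 h2
        obtain ⟨rfl, rfl, rfl, hne⟩ := of_decide_eq_true h
        exact fn hne (sound H hH d _ h1) (sound H hH e _ h2)
      · cases h
    | node x y z f ih =>
      intro H hH h
      simp only [CaseTree.check] at h
      obtain ⟨w, hw⟩ := tot x y z
      refine ih w _ ?_ (of_decide_eq_true h w)
      intro g hg
      rcases List.mem_append.mp hg with hg | hg
      · exact hH g hg
      · rw [List.mem_singleton.mp hg]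
        exact hw
  exact main theTree [] (by simp) theTree_check

theorem mem_zpowers_c {g : Equiv.Perm (Fin 4)} (h : g ∈ Subgroup.zpowers c) :
    g = 1 ∨ g = c := by
  obtain ⟨k, rfl⟩ := Subgroup.mem_zpowers_iff.mp h
  have h2 : c * c = 1 := by decide
  rcases Int.even_or_odd' k with ⟨m, rfl | rfl⟩
  · left
    rw [zpow_mul, zpow_two, h2, one_zpow]
  · right
    rw [zpow_add, zpow_mul, zpow_two, h2, one_zpow, one_mul, zpow_one]

/-- The twelve cosets. -/
def pt (i : Fin 12) : Equiv.Perm (Fin 4) ⧸ Subgroup.zpowers c := QuotientGroup.mk (rep i)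

theorem mk_eq_of {g h : Equiv.Perm (Fin 4)} (H : g = h ∨ g = h * c) :
    (QuotientGroup.mk g : Equiv.Perm (Fin 4) ⧸ Subgroup.zpowers c) = QuotientGroup.mk h := by
  rcases H with rfl | rfl
  · rfl
  · exact QuotientGroup.mk_mul_of_mem h (Subgroup.mem_zpowers c)

theorem pt_inj : ∀ i j, pt i = pt j → i = j := by
  intro i j h
  have := mem_zpowers_c (QuotientGroup.eq.mp h)
  revert i j
  have key : ∀ i j, (rep i)⁻¹ * rep j = 1 ∨ (rep i)⁻¹ * rep j = c → i = j := by decide +kernel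
  intro i j _ h
  exact key i j h

theorem pt_surj : ∀ x, ∃ i, pt i = x := by
  have key : ∀ g : Equiv.Perm (Fin 4), ∃ i, rep i = g ∨ rep i = g * c := by decide +kernel
  intro x
  induction x using QuotientGroup.induction_on with
  | H g =>
    obtain ⟨i, hi⟩ := key g
    exact ⟨i, mk_eq_of hi⟩

theorem pt_S (i : Fin 12) : genS • pt i = pt (tabS i) := by
  have key : ∀ i, genS * rep i = rep (tabS i) ∨ genS * rep i = rep (tabS i) * c := by
    decide +kernel
  exact mk_eq_of (key i)

theorem pt_T (i : Fin 12) : genT • pt i = pt (tabT i) := by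
  have key : ∀ i, genT * rep i = rep (tabT i) ∨ genT * rep i = rep (tabT i) * c := by
    decide +kernel
  exact mk_eq_of (key i)

/-- Let `C = ⟨(1 3)(2 4)⟩ ≤ S₄`. No regular subgroup of `Sym(S₄⧸C)` (a symmetric group on
12 points) is normalized by the image of the left-translation map `λ : S₄ → Sym(S₄⧸C)`. -/
theorem s4_mod_double_transposition_not_hopfGalois :
    ¬ ∃ N : Subgroup (Equiv.Perm (Equiv.Perm (Fin 4) ⧸ Subgroup.zpowers c)),
        IsRegularSubgroup N ∧
        (MulAction.toPermHom (Equiv.Perm (Fin 4))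
          (Equiv.Perm (Fin 4) ⧸ Subgroup.zpowers c)).range ≤ Subgroup.normalizer (N : Set _) := by
  rintro ⟨N, ⟨htrans, hfree⟩, hnorm⟩
  have huniq : ∀ σ ∈ N, ∀ τ ∈ N, ∀ x, σ x = τ x → σ = τ := by
    intro σ hσ τ hτ x hx
    have := hfree (τ⁻¹ * σ) (N.mul_mem (N.inv_mem hτ) hσ) x (by simp [hx])
    exact (inv_mul_eq_one.mp this).symm
  have hact : ∀ (g : Equiv.Perm (Fin 4)) (f : Fin 12 → Fin 12),
      (∀ i, g • pt i = pt (f i)) → ∀ x y z w,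
      (∃ σ ∈ N, σ (pt x) = pt y ∧ σ (pt z) = pt w) →
      ∃ σ ∈ N, σ (pt (f x)) = pt (f y) ∧ σ (pt (f z)) = pt (f w) := by
    rintro g f hf x y z w ⟨σ, hσ, h1, h2⟩
    have hg := hnorm ⟨g, rfl⟩
    refine ⟨_, (Subgroup.mem_normalizer_iff.mp hg σ).mp hσ, ?_, ?_⟩
    · simp [← hf, h1]
    · simp [← hf, h2]
  refine heap_core (fun x y z w => ∃ σ ∈ N, σ (pt x) = pt y ∧ σ (pt z) = pt w)
    ?_ ?_ ?_ ?_ ?_ ?_ ?_ ?_ (hact genS tabS pt_S _ _ _ _) (hact genT tabT pt_T _ _ _ _)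
  · intro x y z
    obtain ⟨σ, hσ, h⟩ := htrans (pt x) (pt y)
    obtain ⟨w, hw⟩ := pt_surj (σ (pt z))
    exact ⟨w, σ, hσ, h, hw.symm⟩
  · rintro x y z w w' hne ⟨σ, hσ, h1, h2⟩ ⟨τ, hτ, h3, h4⟩
    have := huniq σ hσ τ hτ _ (h1.trans h3.symm)
    subst this
    exact hne (pt_inj _ _ (h2.symm.trans h4))
  · intro x y
    obtain ⟨σ, hσ, h⟩ := htrans (pt x) (pt y)
    exact ⟨σ, hσ, h, h⟩
  · intro x z
    exact ⟨1, N.one_mem, rfl, rfl⟩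
  · rintro x y z w ⟨σ, hσ, h1, h2⟩
    exact ⟨σ, hσ, h2, h1⟩
  · rintro x y z w ⟨σ, hσ, h1, h2⟩
    exact ⟨σ⁻¹, N.inv_mem hσ, by simp [← h1], by simp [← h2]⟩
  · rintro x y z w u v ⟨σ, hσ, h1, h2⟩ ⟨τ, hτ, h3, h4⟩
    have := huniq σ hσ τ hτ _ (h2.trans h3.symm)
    subst this
    exact ⟨σ, hσ, h1, h4⟩
  · rintro x y z w u v ⟨σ, hσ, h1, h2⟩ ⟨τ, hτ, h3, h4⟩
    exact ⟨τ * σ, N.mul_mem hτ hσ, by simp [h1, h3], by simp [h2, h4]⟩
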